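/- Let X and X' be Polish spaces (separable, completely metrizable), μ and μ' Borel probability measures on X and X' respectively, and R ⊂ X × X, R' ⊂ X' × X' Borel sets viewed as binary relations. Suppose that for every k ∈ ℕ the laws of the random adjacency matrices coincide: C^k_♯ μ^⊗k = C'^k_♯ μ'^⊗k. Then there exist sequences (x_i)_{i∈ℕ} in X and (x'_i)_{i∈ℕ} in X' such that (x_i) is generic for μ, (x'_i) is generic for μ', and for all i, j ∈ ℕ one has (x_i, x_j) ∈ R if and only if (x'_i, x'_j) ∈ R'. -/

import Mathlib

open MeasureTheory Filter Topology
open scoped BoundedContinuousFunction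

/-- A sequence `x : ℕ → X` is *generic* for a Borel probability measure `μ` if its empirical
measures converge narrowly to `μ`, i.e. the averages of every bounded continuous function along
the sequence converge to its `μ`-integral. -/
def Generic {X : Type*} [TopologicalSpace X] [MeasurableSpace X]
    (μ : Measure X) (x : ℕ → X) : Prop :=
  ∀ φ : X →ᵇ ℝ,
    Tendsto (fun n : ℕ => (∑ i ∈ Finset.range n, φ (x i)) / (n : ℝ))
      atTop (𝓝 (∫ a, φ a ∂μ))

/-- The adjacency map `C^k : X^k → {0,1}^{k×k}` induced by a binary relation `R ⊆ X × X`: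
`C^k(x)_{ij} = 1` iff `(x i, x j) ∈ R`. -/
noncomputable def adjMat {X : Type*} (R : Set (X × X)) (k : ℕ)
    (x : Fin k → X) : Fin k → Fin k → Bool :=
  fun i j => by classical exact if (x i, x j) ∈ R then true else false

/-- The uniform probability measure on the first `n + 1` terms of a sequence. -/
noncomputable def empiricalMeasure {X : Type*} [MeasurableSpace X] (x : ℕ → X) (n : ℕ) :
    Measure X :=
  ((n + 1 : ℕ) : ENNReal)⁻¹ • ∑ i ∈ Finset.range (n + 1), Measure.dirac (x i)

instance isProbabilityMeasure_empiricalMeasure {X : Type*} [MeasurableSpace X] (x : ℕ → X)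
    (n : ℕ) : IsProbabilityMeasure (empiricalMeasure x n) := by
  constructor
  simp only [empiricalMeasure, Measure.smul_apply, Measure.finsetSum_apply, measure_univ,
    Finset.sum_const, Finset.card_range, smul_eq_mul, nsmul_eq_mul, mul_one]
  exact ENNReal.inv_mul_cancel (by simp) (by simp)

lemma integral_empiricalMeasure {X : Type*} [MeasurableSpace X] (x : ℕ → X) (n : ℕ)
    {f : X → ℝ} (hf : StronglyMeasurable f) :
    ∫ a, f a ∂empiricalMeasure x n
      = (∑ i ∈ Finset.range (n + 1), f (x i)) / ((n + 1 : ℕ) : ℝ) := by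
  rw [empiricalMeasure, integral_smul_measure, integral_finsetSum_measure]
  · simp only [integral_dirac' _ _ hf, ENNReal.toReal_inv, ENNReal.toReal_natCast, smul_eq_mul]
    rw [div_eq_inv_mul]
  · intro i _
    exact integrable_dirac' hf (by simp)

/-- If the visit frequencies to every set of a π-system containing arbitrarily small neighbourhoods
converge to the measures of these sets, then the sequence is generic. -/
lemma generic_of_tendsto_frequency {X : Type*} [TopologicalSpace X] [PolishSpace X]
    [MeasurableSpace X] [BorelSpace X] (μ : Measure X) [IsProbabilityMeasure μ] (x : ℕ → X)
    {S : Set (Set X)} (hS : IsPiSystem S) (hmeas : ∀ s ∈ S, MeasurableSet s)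
    (hnhds : ∀ u : Set X, IsOpen u → ∀ a ∈ u, ∃ s ∈ S, s ∈ 𝓝 a ∧ s ⊆ u)
    (hx : ∀ s ∈ S, Tendsto
      (fun n : ℕ => (∑ i ∈ Finset.range n, s.indicator (fun _ => (1 : ℝ)) (x i)) / (n : ℝ))
      atTop (𝓝 (μ.real s))) :
    Generic μ x := by
  let ν : ℕ → ProbabilityMeasure X := fun n => ⟨empiricalMeasure x n, inferInstance⟩
  let ν₀ : ProbabilityMeasure X := ⟨μ, inferInstance⟩
  have hlim : Tendsto ν atTop (𝓝 ν₀) := by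
    refine hS.tendsto_probabilityMeasure_of_tendsto_of_mem hmeas hnhds fun s hs => ?_
    rw [← NNReal.tendsto_coe]
    have hcomp := (hx s hs).comp (tendsto_add_atTop_nat 1)
    refine hcomp.congr fun n => ?_
    have hint := integral_empiricalMeasure x n
      (stronglyMeasurable_const.indicator (hmeas s hs) : StronglyMeasurable
        (s.indicator fun _ : X => (1 : ℝ)))
    rw [integral_indicator_const _ (hmeas s hs), smul_eq_mul, mul_one] at hint
    exact hint.symm
  intro φ
  rw [← tendsto_add_atTop_iff_nat 1]
  refine ((ProbabilityMeasure.tendsto_iff_forall_integral_tendsto.mp hlim) φ).congr fun n => ?_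
  exact integral_empiricalMeasure x n φ.continuous.stronglyMeasurable

/-- A second countable space has a countable π-system of open sets forming a basis. -/
lemma exists_countable_isPiSystem_nhds (X : Type*) [TopologicalSpace X]
    [SecondCountableTopology X] :
    ∃ S : Set (Set X), S.Countable ∧ IsPiSystem S ∧ (∀ s ∈ S, IsOpen s) ∧
      ∀ u : Set X, IsOpen u → ∀ a ∈ u, ∃ s ∈ S, s ∈ 𝓝 a ∧ s ⊆ u := by
  have hB := TopologicalSpace.isBasis_countableBasis X
  refine ⟨Set.sInter '' {f | f.Finite ∧ f ⊆ TopologicalSpace.countableBasis X},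
    (Set.countable_ofPred_finite_subset (TopologicalSpace.countable_countableBasis X)).image _,
    ?_, ?_, ?_⟩
  · rintro _ ⟨f, ⟨hf, hfB⟩, rfl⟩ _ ⟨g, ⟨hg, hgB⟩, rfl⟩ _
    exact ⟨f ∪ g, ⟨hf.union hg, Set.union_subset hfB hgB⟩, Set.sInter_union f g⟩
  · rintro _ ⟨f, ⟨hf, hfB⟩, rfl⟩
    exact hf.isOpen_sInter fun s hs => hB.isOpen (hfB hs)
  · intro u hu a ha
    obtain ⟨v, hv, hav, hvu⟩ := hB.exists_subset_of_mem_open ha hu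
    exact ⟨v, ⟨{v}, ⟨Set.finite_singleton v, by simpa using hv⟩, Set.sInter_singleton v⟩,
      (hB.isOpen hv).mem_nhds hav, hvu⟩

/-- Almost every sequence of independent `μ`-distributed points is generic for `μ`. -/
lemma ae_generic_infinitePi {X : Type*} [TopologicalSpace X] [PolishSpace X]
    [MeasurableSpace X] [BorelSpace X] (μ : Measure X) [IsProbabilityMeasure μ] :
    ∀ᵐ x ∂Measure.infinitePi fun _ : ℕ => μ, Generic μ x := by
  obtain ⟨S, hScount, hSpi, hSopen, hSnhds⟩ := exists_countable_isPiSystem_nhds X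
  have hfreq : ∀ᵐ x ∂Measure.infinitePi fun _ : ℕ => μ, ∀ s ∈ S, Tendsto
      (fun n : ℕ => (∑ i ∈ Finset.range n, s.indicator (fun _ => (1 : ℝ)) (x i)) / (n : ℝ))
      atTop (𝓝 (μ.real s)) := by
    rw [ae_ball_iff hScount]
    intro s hs
    have hsm : MeasurableSet s := (hSopen s hs).measurableSet
    have hf : Measurable (s.indicator fun _ : X => (1 : ℝ)) := measurable_const.indicator hsm
    have heval (i : ℕ) : MeasurePreserving (fun x : ℕ → X => x i)
        (Measure.infinitePi fun _ : ℕ => μ) μ :=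
      measurePreserving_eval_infinitePi (fun _ : ℕ => μ) i
    have hslln := ProbabilityTheory.strong_law_ae_real
      (μ := Measure.infinitePi fun _ : ℕ => μ)
      (fun i x => s.indicator (fun _ => (1 : ℝ)) (x i))
      ((heval 0).integrable_comp_of_integrable ((integrable_const 1).indicator hsm))
      (fun i j hij => (ProbabilityTheory.iIndepFun_infinitePi (P := fun _ : ℕ => μ)
        (fun _ => hf)).indepFun hij)
      (fun i => ⟨(hf.comp (heval i).measurable).aemeasurable,
        (hf.comp (heval 0).measurable).aemeasurable, by
          have hmap (j : ℕ) := Measure.map_map (μ := Measure.infinitePi fun _ : ℕ => μ)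
            hf (heval j).measurable
          simp only [(heval _).map_eq] at hmap
          exact (hmap i).symm.trans (hmap 0)⟩)
    have hmean : ∫ x : ℕ → X, s.indicator (fun _ => (1 : ℝ)) (x 0)
        ∂Measure.infinitePi (fun _ : ℕ => μ) = μ.real s := by
      rw [← integral_map (φ := fun x : ℕ → X => x 0) (heval 0).measurable.aemeasurable
        hf.aestronglyMeasurable, (heval 0).map_eq, integral_indicator_const _ hsm]
      simp
    rw [hmean] at hslln
    exact hslln
  filter_upwards [hfreq] with x hx
  exact generic_of_tendsto_frequency μ x hSpi (fun s hs => (hSopen s hs).measurableSet) hSnhds hx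

/-- If `f` is a random variable and `p` holds almost surely, then for almost every value `b` of `f`
there is a point satisfying `p` at which `f` takes the value `b`. -/
lemma ae_map_exists_eq {Ω B : Type*} [MeasurableSpace Ω] [StandardBorelSpace Ω]
    [MeasurableSpace B] [MeasurableEq B] {P : Measure Ω} [IsProbabilityMeasure P]
    {f : Ω → B} (hf : Measurable f) {p : Ω → Prop} (hp : ∀ᵐ ω ∂P, p ω) :
    ∀ᵐ b ∂P.map f, ∃ ω, p ω ∧ f ω = b := by
  have : Nonempty Ω := P.nonempty_of_neZero
  have hpair : Measurable fun ω => (f ω, ω) := hf.prodMk measurable_id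
  have hgraph : ∀ᵐ q ∂P.map fun ω => (f ω, ω), f q.2 = q.1 := by
    exact (ae_map_iff hpair.aemeasurable
      (measurableSet_eq_fun (hf.comp measurable_snd) measurable_fst)).mpr
      (ae_of_all _ fun _ => rfl)
  have hsnd : ∀ᵐ q ∂P.map fun ω => (f ω, ω), p q.2 := by
    refine ae_of_ae_map measurable_snd.aemeasurable ?_
    rw [Measure.map_map measurable_snd hpair]
    simpa [Function.comp_def] using hp
  have : IsProbabilityMeasure (P.map fun ω => (f ω, ω)) :=
    Measure.isProbabilityMeasure_map hpair.aemeasurable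
  have hboth := hsnd.and hgraph
  rw [← (P.map fun ω => (f ω, ω)).disintegrate (P.map fun ω => (f ω, ω)).condKernel] at hboth
  have hcond := Measure.ae_ae_of_ae_compProd hboth
  rw [Measure.fst, Measure.map_map measurable_fst hpair] at hcond
  filter_upwards [hcond] with b hb
  exact hb.exists

/-- The infinite adjacency matrix of a sequence, indexed by pairs. -/
noncomputable def infAdj {X : Type*} (R : Set (X × X)) (x : ℕ → X) : ℕ × ℕ → Bool :=
  fun q => by classical exact if (x q.1, x q.2) ∈ R then true else false

lemma measurable_infAdj {X : Type*} [MeasurableSpace X] {R : Set (X × X)}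
    (hR : MeasurableSet R) : Measurable (infAdj R) := by
  classical
  refine measurable_pi_lambda _ fun q => ?_
  exact Measurable.ite (((measurable_pi_apply q.1).prodMk (measurable_pi_apply q.2)) hR)
    measurable_const measurable_const

lemma measurable_adjMat {X : Type*} [MeasurableSpace X] {R : Set (X × X)}
    (hR : MeasurableSet R) (k : ℕ) : Measurable (adjMat R k) := by
  classical
  refine measurable_pi_lambda _ fun i => measurable_pi_lambda _ fun j => ?_
  exact Measurable.ite (((measurable_pi_apply i).prodMk (measurable_pi_apply j)) hR)
    measurable_const measurable_const

/-- The marginals of the law of the infinite adjacency matrix are determined by the laws of the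
finite adjacency matrices. -/
lemma map_restrict_map_infAdj {X : Type*} [MeasurableSpace X] (μ : Measure X)
    [IsProbabilityMeasure μ] {R : Set (X × X)} (hR : MeasurableSet R) (I : Finset (ℕ × ℕ))
    {k : ℕ} (hk : ∀ q : I, q.1.1 < k ∧ q.1.2 < k) :
    ((Measure.infinitePi fun _ : ℕ => μ).map (infAdj R)).map I.restrict
      = ((Measure.pi fun _ : Fin k => μ).map (adjMat R k)).map
        fun M (q : I) => M ⟨q.1.1, (hk q).1⟩ ⟨q.1.2, (hk q).2⟩ := by
  have hM : Measurable fun (M : Fin k → Fin k → Bool) (q : I) =>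
      M ⟨q.1.1, (hk q).1⟩ ⟨q.1.2, (hk q).2⟩ := by fun_prop
  rw [← Measure.infinitePi_eq_pi, ← Measure.map_infinitePi_infinitePi_of_inj
      (P := fun _ : ℕ => μ) (f := ((↑) : Fin k → ℕ)) Fin.val_injective,
    Measure.map_map (Finset.measurable_restrict I) (measurable_infAdj hR),
    Measure.map_map hM (measurable_adjMat hR k),
    Measure.map_map (hM.comp (measurable_adjMat hR k)) (by fun_prop)]
  rfl

lemma map_infAdj_eq_of_map_adjMat_eq {X X' : Type*} [MeasurableSpace X] [MeasurableSpace X']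
    (μ : Measure X) [IsProbabilityMeasure μ] (μ' : Measure X') [IsProbabilityMeasure μ']
    {R : Set (X × X)} (hR : MeasurableSet R) {R' : Set (X' × X')} (hR' : MeasurableSet R')
    (h : ∀ k : ℕ, (Measure.pi fun _ : Fin k => μ).map (adjMat R k)
      = (Measure.pi fun _ : Fin k => μ').map (adjMat R' k)) :
    (Measure.infinitePi fun _ : ℕ => μ).map (infAdj R)
      = (Measure.infinitePi fun _ : ℕ => μ').map (infAdj R') := by
  refine IsProjectiveLimit.unique
    (P := fun I : Finset (ℕ × ℕ) =>
      ((Measure.infinitePi fun _ : ℕ => μ').map (infAdj R')).map I.restrict)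
    (fun I => ?_) (fun I => rfl)
  have hk (q : I) : q.1.1 < I.sup (fun q => max q.1 q.2) + 1 ∧
      q.1.2 < I.sup (fun q => max q.1 q.2) + 1 := by
    have hq := Finset.le_sup (f := fun q : ℕ × ℕ => max q.1 q.2) q.2
    simp only [max_le_iff] at hq
    omega
  beta_reduce
  rw [map_restrict_map_infAdj μ hR I hk, map_restrict_map_infAdj μ' hR' I hk, h]

/-- Let `X` and `X'` be Polish spaces, `μ`, `μ'` Borel probability measures on
them, and `R ⊆ X × X`, `R' ⊆ X' × X'` Borel binary relations. If for every `k ∈ ℕ` the laws of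
the random adjacency matrices coincide, `C^k_♯ μ^⊗k = C'^k_♯ μ'^⊗k`, then there exist sequences
`(x_i)` in `X` generic for `μ` and `(x'_i)` in `X'` generic for `μ'` such that for all `i, j`,
`(x_i, x_j) ∈ R ⟺ (x'_i, x'_j) ∈ R'`. -/
theorem exists_generic_chronologically_isomorphic_sequences
    {X X' : Type*}
    [TopologicalSpace X] [PolishSpace X] [MeasurableSpace X] [BorelSpace X]
    [TopologicalSpace X'] [PolishSpace X'] [MeasurableSpace X'] [BorelSpace X']
    (μ : Measure X) [IsProbabilityMeasure μ] (μ' : Measure X') [IsProbabilityMeasure μ']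
    (R : Set (X × X)) (hR : MeasurableSet R)
    (R' : Set (X' × X')) (hR' : MeasurableSet R')
    (h : ∀ k : ℕ, (Measure.pi fun _ : Fin k => μ).map (adjMat R k)
      = (Measure.pi fun _ : Fin k => μ').map (adjMat R' k)) :
    ∃ (x : ℕ → X) (x' : ℕ → X'), Generic μ x ∧ Generic μ' x' ∧
      ∀ i j : ℕ, (x i, x j) ∈ R ↔ (x' i, x' j) ∈ R' := by

  have hae := ae_map_exists_eq (measurable_infAdj hR) (ae_generic_infinitePi μ)
  have hae' := ae_map_exists_eq (measurable_infAdj hR') (ae_generic_infinitePi μ')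
  rw [← map_infAdj_eq_of_map_adjMat_eq μ μ' hR hR' h] at hae'
  have : IsProbabilityMeasure ((Measure.infinitePi fun _ : ℕ => μ).map (infAdj R)) :=
    Measure.isProbabilityMeasure_map (measurable_infAdj hR).aemeasurable
  obtain ⟨b, ⟨x, hx, hxb⟩, x', hx', hxb'⟩ := (hae.and hae').exists
  refine ⟨x, x', hx, hx', fun i j => ?_⟩
  have hij := congrFun (hxb.trans hxb'.symm) (i, j)
  simp only [infAdj] at hij
  split_ifs at hij <;> simp_all
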